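/- arXiv:1412.7985 — 9 statements merged into one kernel-verified Lean document; each statement's English description precedes it below -/
import Mathlib

section
/- Let g(x,t) = 1/t + (x/t)·log(1/(1−t)) for x ≥ 1 and t ∈ (0,1), let G(x) = inf_{0<t<1} g(x,t), and define the sequence β by β(1) = 1 and β(n+1) = G(β(n)) for n ≥ 1. Then (1/2)·n² ≤ β(n) for all n ≥ 1, and β(n) ≤ (1/2)·n² + n·log(n) for all n ≥ 2. -/
open Set

/-- `g x t = 1/t + (x/t)·log(1/(1−t))`. -/
noncomputable def g (x t : ℝ) : ℝ := 1 / t + (x / t) * Real.log (1 / (1 - t))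

/-- `G x = inf_{0<t<1} g x t`. -/
noncomputable def G (x : ℝ) : ℝ := sInf ((fun t => g x t) '' Set.Ioo (0 : ℝ) 1)

/-- The sequence `β` with `β 1 = 1` and `β (n+1) = G (β n)` for `n ≥ 1`
(the value at `0` is irrelevant). -/
noncomputable def beta : ℕ → ℝ
  | 0 => 0
  | 1 => 1
  | n + 2 => G (beta (n + 1))

lemma add_mul_sq_ge {t : ℝ} (h0 : 0 < t) (h1 : t < 1) (n : ℝ) :
    n + 1 / 2 ≤ 1 / t + n ^ 2 * (t / 4 + t ^ 2 / 6 + t ^ 3 / 8) := by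
  set c := t / 4 + t ^ 2 / 6 + t ^ 3 / 8 with hc
  have hc0 : 0 < c := by positivity
  have hdisc : 1 ≤ 4 * c * (1 / t - 1 / 2) := by
    have h : 4 * c * (1 / t - 1 / 2) = 1 + t * (2 + 2 * t - 3 * t ^ 2) / 12 := by
      rw [hc]
      field_simp
      ring
    have : 0 ≤ t * (2 + 2 * t - 3 * t ^ 2) := mul_nonneg h0.le (by nlinarith)
    linarith
  have hsq : 0 ≤ 4 * c * (1 / t - 1 / 2 - n + n ^ 2 * c) := by
    nlinarith [sq_nonneg (2 * c * n - 1)]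
  have := nonneg_of_mul_nonneg_right hsq (by positivity)
  linarith

lemma sum_four_le_log_inv {t : ℝ} (h0 : 0 < t) (h1 : t < 1) :
    t + t ^ 2 / 2 + t ^ 3 / 3 + t ^ 4 / 4 ≤ Real.log (1 / (1 - t)) := by
  have hs := Real.hasSum_pow_div_log_of_abs_lt_one (abs_lt.2 ⟨by linarith, h1⟩)
  have := sum_le_hasSum (Finset.range 4) (fun i _ => by positivity) hs
  rw [one_div, Real.log_inv]
  norm_num [Finset.sum_range_succ] at this
  linarith

lemma log_inv_nonneg {t : ℝ} (h0 : 0 < t) (h1 : t < 1) : 0 ≤ Real.log (1 / (1 - t)) :=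
  le_trans (by positivity) (sum_four_le_log_inv h0 h1)

lemma sq_succ_le_g {n x t : ℝ} (h0 : 0 < t) (h1 : t < 1) (hx : 1 / 2 * n ^ 2 ≤ x) :
    1 / 2 * (n + 1) ^ 2 ≤ g x t := by
  have hL := sum_four_le_log_inv h0 h1
  have key := add_mul_sq_ge h0 h1 n
  have hmul : 1 / 2 * n ^ 2 / t * (t + t ^ 2 / 2 + t ^ 3 / 3 + t ^ 4 / 4)
      ≤ x / t * Real.log (1 / (1 - t)) := by
    have : 0 ≤ x := le_trans (by positivity) hx
    gcongr
  have heq : 1 / 2 * n ^ 2 / t * (t + t ^ 2 / 2 + t ^ 3 / 3 + t ^ 4 / 4)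
      = 1 / 2 * n ^ 2 + n ^ 2 * (t / 4 + t ^ 2 / 6 + t ^ 3 / 8) := by
    field_simp
    ring
  unfold g
  linarith

lemma sq_succ_le_G {n x : ℝ} (hx : 1 / 2 * n ^ 2 ≤ x) : 1 / 2 * (n + 1) ^ 2 ≤ G x := by
  refine le_csInf (Set.Nonempty.image _ ⟨1 / 2, by norm_num, by norm_num⟩) ?_
  rintro _ ⟨t, ht, rfl⟩
  exact sq_succ_le_g ht.1 ht.2 hx

lemma G_le_g {x t : ℝ} (hx : 0 ≤ x) (h0 : 0 < t) (h1 : t < 1) : G x ≤ g x t := by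
  refine csInf_le ⟨0, ?_⟩ ⟨t, ⟨h0, h1⟩, rfl⟩
  rintro _ ⟨s, hs, rfl⟩
  have := log_inv_nonneg hs.1 hs.2
  have := hs.1
  simp only [g]
  positivity

lemma beta_succ {n : ℕ} (hn : 1 ≤ n) : beta (n + 1) = G (beta n) := by
  obtain ⟨m, rfl⟩ := Nat.exists_eq_add_of_le' hn
  rfl

lemma log_div_sub_one_le {n : ℝ} (hn : 2 ≤ n) :
    Real.log ((n + 1) / (n - 1)) ≤ 2 / n * (1 + 2 / ((n + 1) * (3 * n - 2))) := by
  have h := Real.log_div_le_sum_range_add (x := 1 / n) (by positivity)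
    (by rw [div_lt_one (by linarith)]; linarith) 2
  have hq : (1 + 1 / n) / (1 - 1 / n) = (n + 1) / (n - 1) := by
    have : n - 1 ≠ 0 := by linarith
    field_simp
  rw [hq] at h
  norm_num [Finset.sum_range_succ] at h
  have hn1 : 0 < n - 1 := by linarith
  have hn2 : 0 < 3 * n - 2 := by linarith
  have hsq : 1 - (n ^ 2)⁻¹ = (n + 1) * (n - 1) / n ^ 2 := by
    field_simp
    ring
  rw [hsq] at h
  have hne : n * 3 - 2 ≠ 0 := by linarith
  have hd : 2 / n * (1 + 2 / ((n + 1) * (3 * n - 2)))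
      - 2 * (n⁻¹ + (n ^ 3)⁻¹ / 3 + (n ^ 5)⁻¹ / ((n + 1) * (n - 1) / n ^ 2))
      = 2 * (n - 2) * (3 * n ^ 2 + 2 * n - 2)
        / (3 * n ^ 3 * (n + 1) * (n - 1) * (3 * n - 2)) := by
    field_simp
    ring
  have : 0 ≤ 2 * (n - 2) * (3 * n ^ 2 + 2 * n - 2)
        / (3 * n ^ 3 * (n + 1) * (n - 1) * (3 * n - 2)) := by
    have : 0 ≤ n - 2 := by linarith
    have : 0 ≤ 3 * n ^ 2 + 2 * n - 2 := by nlinarith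
    positivity
  linarith

lemma G_le_sq_succ_add {n x : ℝ} (hn : 2 ≤ n) (h0 : 0 ≤ x)
    (hx : x ≤ 1 / 2 * n ^ 2 + n * Real.log n) :
    G x ≤ 1 / 2 * (n + 1) ^ 2 + (n + 1) * Real.log (n + 1) := by
  have hn1 : 0 < n - 1 := by linarith
  have hn2 : 0 < 3 * n - 2 := by linarith
  have hℓ : Real.log n ≤ n - 1 := Real.log_le_sub_one_of_pos (by linarith)
  have hℓ0 : 0 ≤ Real.log n := Real.log_nonneg (by linarith)
  have hstep : Real.log n + 1 / (n + 1) ≤ Real.log (n + 1) := by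
    have h := Real.one_sub_inv_le_log_of_pos (x := (n + 1) / n) (by positivity)
    rw [Real.log_div (by positivity) (by positivity)] at h
    have : 1 - ((n + 1) / n)⁻¹ = 1 / (n + 1) := by
      field_simp
      ring
    linarith
  have hG := G_le_g (t := 2 / (n + 1)) h0 (by positivity)
    (by rw [div_lt_one (by linarith)]; linarith)
  have hg : g x (2 / (n + 1)) = (n + 1) / 2 * (1 + x * Real.log ((n + 1) / (n - 1))) := by
    have : 1 / (1 - 2 / (n + 1)) = (n + 1) / (n - 1) := by
      have : 1 - 2 / (n + 1) = (n - 1) / (n + 1) := by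
        field_simp
        ring
      rw [this, one_div_div]
    unfold g
    rw [this]
    field_simp
  have hxL : x * Real.log ((n + 1) / (n - 1)) ≤
      (1 / 2 * n ^ 2 + n * Real.log n) * (2 / n * (1 + 2 / ((n + 1) * (3 * n - 2)))) :=
    mul_le_mul hx (log_div_sub_one_le hn)
      (Real.log_nonneg (by rw [le_div_iff₀ hn1]; linarith)) (by positivity)
  have hexp : (n + 1) / 2 * (1 + (1 / 2 * n ^ 2 + n * Real.log n) *
      (2 / n * (1 + 2 / ((n + 1) * (3 * n - 2)))))
      = 1 / 2 * (n + 1) ^ 2 + (n + 1) * Real.log n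
        + (n + 2 * Real.log n) / (3 * n - 2) := by
    field_simp
    ring
  have hrem : (n + 2 * Real.log n) / (3 * n - 2) ≤ 1 := by
    rw [div_le_one hn2]
    linarith
  have hmain : (n + 1) * (Real.log n + 1 / (n + 1)) ≤ (n + 1) * Real.log (n + 1) := by
    gcongr
  have hone : (n + 1) * (Real.log n + 1 / (n + 1)) = (n + 1) * Real.log n + 1 := by
    field_simp
  have : (n + 1) / 2 * (1 + x * Real.log ((n + 1) / (n - 1))) ≤
      (n + 1) / 2 * (1 + (1 / 2 * n ^ 2 + n * Real.log n) *
        (2 / n * (1 + 2 / ((n + 1) * (3 * n - 2))))) := by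
    gcongr
  linarith

lemma beta_two_le : beta 2 ≤ 2 + 2 * Real.log 2 := by
  have hG : beta 2 ≤ g 1 (2 / 3) :=
    G_le_g zero_le_one (by norm_num) (by norm_num)
  have hg : g 1 (2 / 3) = 3 / 2 + 3 / 2 * Real.log 3 := by
    norm_num [g]
  have h3 : Real.log 3 ≤ Real.log 2 + 1 / 2 := by
    have h := Real.log_le_sub_one_of_pos (x := 3 / 2) (by norm_num)
    rw [Real.log_div (by norm_num) (by norm_num)] at h
    linarith
  have := Real.log_two_gt_d9
  linarith

lemma half_sq_le_beta (n : ℕ) (hn : 1 ≤ n) : (1 / 2 : ℝ) * (n : ℝ) ^ 2 ≤ beta n := by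
  induction n, hn using Nat.le_induction with
  | base => norm_num [beta]
  | succ n hn ih =>
    rw [beta_succ hn]
    push_cast
    exact sq_succ_le_G ih

theorem beta_bounds :
    (∀ n : ℕ, 1 ≤ n → (1 / 2 : ℝ) * (n : ℝ) ^ 2 ≤ beta n) ∧
    (∀ n : ℕ, 2 ≤ n → beta n ≤ (1 / 2 : ℝ) * (n : ℝ) ^ 2 + (n : ℝ) * Real.log n) := by
  refine ⟨half_sq_le_beta, fun n hn => ?_⟩
  induction n, hn using Nat.le_induction with
  | base =>
    have := beta_two_le
    push_cast
    linarith
  | succ n hn ih =>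
    rw [beta_succ (by omega)]
    push_cast
    exact G_le_sq_succ_add (by exact_mod_cast hn)
      (le_trans (by positivity) (half_sq_le_beta n (by omega))) ih
end

section
/- Let g(x,t) = 1/t + (x/t)·log(1/(1−t)) for x ≥ 1 and t ∈ (0,1), and let G(x) = inf_{0<t<1} g(x,t). Then for all x ≥ 1 one has (1/2)·(x+1)² ≤ G((1/2)·x²). -/
open Set

/-- The first Padé lower bound for `-log (1 - t)`. -/
theorem two_mul_div_le_log_one_div_one_sub {t : ℝ} (h0 : 0 ≤ t) (h1 : t < 1) :
    2 * t / (2 - t) ≤ Real.log (1 / (1 - t)) := by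
  have h : 0 < 1 - t := by linarith
  have h2 : 2 - t ≠ 0 := by linarith
  have key := Real.le_log_one_add_of_nonneg (div_nonneg h0 h.le)
  have e1 : 1 + t / (1 - t) = 1 / (1 - t) := by
    field_simp
    ring
  have e2 : t / (1 - t) + 2 = (2 - t) / (1 - t) := by
    field_simp
    ring
  have e3 : 2 * (t / (1 - t)) / ((2 - t) / (1 - t)) = 2 * t / (2 - t) := by
    field_simp
  rwa [e1, e2, e3] at key

theorem half_mul_add_one_sq_le_g (x : ℝ) {t : ℝ} (h0 : 0 < t) (h1 : t < 1) :
    (1 / 2 : ℝ) * (x + 1) ^ 2 ≤ g ((1 / 2 : ℝ) * x ^ 2) t := by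
  have h2 : 0 < 2 - t := by linarith
  calc (1 / 2 : ℝ) * (x + 1) ^ 2
      ≤ (1 / 2 : ℝ) * (x + 1) ^ 2 + (x * t - (2 - t)) ^ 2 / (2 * t * (2 - t)) :=
        le_add_of_nonneg_right (by positivity)
    _ = 1 / t + (1 / 2 * x ^ 2 / t) * (2 * t / (2 - t)) := by
        field_simp
        ring
    _ ≤ g ((1 / 2 : ℝ) * x ^ 2) t := by
        unfold g
        gcongr
        exact two_mul_div_le_log_one_div_one_sub h0.le h1

theorem lower_bounding_G_recursion :
    ∀ x : ℝ, 1 ≤ x → (1 / 2 : ℝ) * (x + 1) ^ 2 ≤ G ((1 / 2 : ℝ) * x ^ 2) := by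
  intro x _
  refine le_csInf ((nonempty_Ioo.2 one_pos).image _) ?_
  rintro _ ⟨t, ht, rfl⟩
  exact half_mul_add_one_sq_le_g x ht.1 ht.2
end

section
/- For all real x ≥ 1 and all t ∈ (0,1) one has δ(x,t) := (x+1)²·t − 2 − x²·log(1/(1−t)) ≤ 0. -/
/-- The lower bound `(2 * x - 1) / (2 * x ^ 2) ≤ log (1 + 1 / x)`, cleared of denominators. -/
lemma two_mul_sub_one_le_sq_mul_log {x : ℝ} (hx : 0 < x) :
    2 * x - 1 ≤ 2 * x ^ 2 * Real.log ((x + 1) / x) := by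
  have hlog := Real.le_log_one_add_of_nonneg (inv_pos.mpr hx).le
  rw [show 1 + x⁻¹ = (x + 1) / x by field_simp,
    show 2 * x⁻¹ / (x⁻¹ + 2) = 2 / (2 * x + 1) by field_simp; ring] at hlog
  calc 2 * x - 1 ≤ 2 * x ^ 2 * (2 / (2 * x + 1)) := by
        rw [← mul_div_assoc, le_div_iff₀ (by positivity)]
        linarith
    _ ≤ 2 * x ^ 2 * Real.log ((x + 1) / x) := by gcongr

/-- For all `x ≥ 1` and `t ∈ (0,1)` one has
`δ(x,t) = (x+1)²·t − 2 − x²·log(1/(1−t)) ≤ 0`. -/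
theorem delta_nonpos :
    ∀ x : ℝ, 1 ≤ x → ∀ t ∈ Set.Ioo (0 : ℝ) 1,
      (x + 1) ^ 2 * t - 2 - x ^ 2 * Real.log (1 / (1 - t)) ≤ 0 := by
  rintro x hx t ⟨-, ht⟩
  have hx0 : 0 < x := by linarith
  have hs : 0 < 1 - t := by linarith
  have htangent := Real.log_le_sub_one_of_pos
    (show 0 < (1 - t) * ((x + 1) / x) ^ 2 by positivity)
  rw [Real.log_mul hs.ne' (by positivity), Real.log_pow] at htangent
  have hscaled := mul_le_mul_of_nonneg_left htangent (sq_nonneg x)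
  have hcancel : x ^ 2 * ((1 - t) * ((x + 1) / x) ^ 2 - 1) =
      (1 - t) * (x + 1) ^ 2 - x ^ 2 := by
    field_simp
  rw [hcancel] at hscaled
  push_cast at hscaled
  rw [one_div, Real.log_inv]
  linarith [two_mul_sub_one_le_sq_mul_log hx0]
end

section
/- Let g(x,t) = 1/t + (x/t)·log(1/(1−t)) for x ≥ 1 and t ∈ (0,1), and let G(x) = inf_{0<t<1} g(x,t). Then for all x ≥ 1 one has G((1/2)·x² + x·log(x)) ≤ (1/2)·(x+1)² + (x+1)·log(x+1). -/
open Set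

theorem g_nonneg {y t : ℝ} (hy : 0 ≤ y) (ht : t ∈ Ioo (0 : ℝ) 1) : 0 ≤ g y t := by
  obtain ⟨h0, h1⟩ := ht
  have hlog : 0 ≤ Real.log (1 / (1 - t)) :=
    Real.log_nonneg ((one_le_div (by linarith)).2 (by linarith))
  unfold g
  positivity

theorem G_le_g_s6 {y t : ℝ} (hy : 0 ≤ y) (ht : t ∈ Ioo (0 : ℝ) 1) : G y ≤ g y t := by
  refine csInf_le ⟨0, ?_⟩ (mem_image_of_mem _ ht)
  rintro _ ⟨s, hs, rfl⟩
  exact g_nonneg hy hs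

theorem log_le_half_sub_inv {w : ℝ} (hw : 1 ≤ w) : Real.log w ≤ (w - w⁻¹) / 2 := by
  rw [← Real.sinh_log (by linarith)]
  exact Real.self_le_sinh_iff.2 (Real.log_nonneg hw)

theorem g_two_div_add_two_le {x y : ℝ} (hx : 0 < x) (hy : 0 ≤ y) :
    g y (2 / (x + 2)) ≤ (x + 2) / 2 + y * ((x + 1) / x) := by
  have hw : 1 / (1 - 2 / (x + 2)) = (x + 2) / x := by
    rw [one_sub_div (by positivity), one_div_div, add_sub_cancel_right]
  have hlog := log_le_half_sub_inv ((one_le_div hx).2 (by linarith : x ≤ x + 2))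
  calc g y (2 / (x + 2))
      = (x + 2) / 2 + y / (2 / (x + 2)) * Real.log ((x + 2) / x) := by
        rw [g, hw, one_div_div]
    _ ≤ (x + 2) / 2 + y / (2 / (x + 2)) * (((x + 2) / x - ((x + 2) / x)⁻¹) / 2) := by
        gcongr
    _ = (x + 2) / 2 + y * ((x + 1) / x) := by
        field_simp
        ring

theorem one_le_add_one_mul_log_sub_log {x : ℝ} (hx : 0 < x) :
    1 ≤ (x + 1) * (Real.log (x + 1) - Real.log x) := by
  have h := Real.one_sub_inv_le_log_of_pos (by positivity : 0 < (x + 1) / x)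
  rw [Real.log_div (by positivity) hx.ne'] at h
  calc (1 : ℝ) = (x + 1) * (1 - ((x + 1) / x)⁻¹) := by
        field_simp
        ring
    _ ≤ _ := by gcongr

theorem upper_bounding_G_recursion :
    ∀ x : ℝ, 1 ≤ x →
      G ((1 / 2 : ℝ) * x ^ 2 + x * Real.log x) ≤
        (1 / 2 : ℝ) * (x + 1) ^ 2 + (x + 1) * Real.log (x + 1) := by
  intro x hx
  have hx0 : 0 < x := by linarith
  have hL : 0 ≤ Real.log x := Real.log_nonneg hx
  have hy : 0 ≤ (1 / 2 : ℝ) * x ^ 2 + x * Real.log x := by positivity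
  have ht : 2 / (x + 2) ∈ Ioo (0 : ℝ) 1 :=
    ⟨by positivity, (div_lt_one (by positivity)).2 (by linarith)⟩
  have hinc := one_le_add_one_mul_log_sub_log hx0
  have hmul : ((1 / 2 : ℝ) * x ^ 2 + x * Real.log x) * ((x + 1) / x)
      = (x / 2 + Real.log x) * (x + 1) := by
    field_simp
  have hg := g_two_div_add_two_le hx0 hy
  rw [hmul] at hg
  refine ((G_le_g_s6 hy ht).trans hg).trans ?_
  linarith
end

section
/- Fix x ≥ 1 and define g(x,t) = 1/t + (x/t)·log(1/(1−t)) for t ∈ (0,1). Then there is a unique t* ∈ (0,1) satisfying the first-order condition 1/x = log(1−t*) + t*/(1−t*); the function t ↦ g(x,t) attains its infimum over (0,1) at t* and at no other point of (0,1); and moreover t* ≤ √(2/x). -/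
open Set

/-- A solution of the first-order condition is the strict minimizer of `g x` on `(0,1)`. -/
theorem g_lt_of_first_order_condition {x r t : ℝ} (hx : 0 < x) (hr : r ∈ Set.Ioo (0 : ℝ) 1)
    (hfoc : 1 / x = Real.log (1 - r) + r / (1 - r)) (ht : t ∈ Set.Ioo (0 : ℝ) 1) (hne : t ≠ r) :
    g x r < g x t := by
  obtain ⟨hr0, hr1⟩ := hr
  obtain ⟨ht0, ht1⟩ := ht
  have ha : 0 < 1 - r := by linarith
  have hb : 0 < 1 - t := by linarith
  have g_eq (s : ℝ) : g x s = x * ((1 / x - Real.log (1 - s)) / s) := by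
    rw [g, one_div (1 - s), Real.log_inv]
    field_simp
    ring
  have hlog : Real.log (1 - t) - Real.log (1 - r) < (1 - t) / (1 - r) - 1 := by
    rw [← Real.log_div hb.ne' ha.ne']
    refine Real.log_lt_sub_one_of_pos (div_pos hb ha) fun h => hne ?_
    rw [div_eq_one_iff_eq ha.ne'] at h
    linarith
  rw [g_eq, g_eq]
  refine mul_lt_mul_of_pos_left ?_ hx
  have hmin : (1 / x - Real.log (1 - r)) / r = 1 / (1 - r) := by
    rw [hfoc]
    field_simp
    ring
  rw [hmin, lt_div_iff₀ ht0, hfoc]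
  have hsum : 1 / (1 - r) * t = r / (1 - r) - ((1 - t) / (1 - r) - 1) := by
    field_simp
    ring
  linarith

theorem sq_div_two_le_log_one_sub_add {t : ℝ} (h0 : 0 ≤ t) (h1 : t < 1) :
    t ^ 2 / 2 ≤ Real.log (1 - t) + t / (1 - t) := by
  have ha : 0 < 1 - t := by linarith
  have hsinh : -Real.log (1 - t) ≤ ((1 - t)⁻¹ - (1 - t)) / 2 := by
    have h := Real.self_le_sinh_iff.2
      (Real.log_nonneg ((one_le_inv₀ ha).2 (by linarith)))
    rwa [Real.sinh_log (inv_pos.2 ha), inv_inv, Real.log_inv] at h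
  have hdiff : t / (1 - t) - t ^ 2 / 2 - ((1 - t)⁻¹ - (1 - t)) / 2 = t ^ 3 / (2 * (1 - t)) := by
    field_simp
    ring
  have hpos : 0 ≤ t ^ 3 / (2 * (1 - t)) := by positivity
  linarith

theorem exists_first_order_condition {c : ℝ} (hc0 : 0 < c) (hc1 : c ≤ 1) :
    ∃ t ∈ Set.Ioo (0 : ℝ) 1, c = Real.log (1 - t) + t / (1 - t) := by
  have hcont : ContinuousOn (fun t : ℝ => Real.log (1 - t) + t / (1 - t)) (Set.Icc 0 (3 / 4)) := by
    have hne : ∀ t ∈ Set.Icc (0 : ℝ) (3 / 4), 1 - t ≠ 0 := fun t ht => by linarith [ht.2]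
    exact (ContinuousOn.log (by fun_prop) hne).add (ContinuousOn.div (by fun_prop) (by fun_prop) hne)
  have hlog : -2 ≤ Real.log (1 - 3 / 4) := by
    have h := Real.one_sub_inv_le_log_of_pos (show (0 : ℝ) < 1 / 2 by norm_num)
    rw [show (1 - 3 / 4 : ℝ) = (1 / 2) ^ 2 by norm_num, Real.log_pow]
    norm_num at h ⊢
    linarith
  obtain ⟨t, ⟨ht0, ht1⟩, htc⟩ := intermediate_value_Icc (by norm_num) hcont
    (show c ∈ Set.Icc _ _ from ⟨by simpa using hc0.le, by norm_num at hlog ⊢; linarith⟩)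
  refine ⟨t, ⟨ht0.lt_of_ne fun h => ?_, by linarith⟩, htc.symm⟩
  subst h
  simp at htc
  linarith

/-- For fixed `x ≥ 1` there is a unique `t* ∈ (0,1)` with `1/x = log(1−t*) + t*/(1−t*)`;
the map `t ↦ g x t` attains its infimum over `(0,1)` at `t*` and at no other point,
and `t* ≤ √(2/x)`. -/
theorem first_order_condition_unique_min (x : ℝ) (hx : 1 ≤ x) :
    ∃ tstar ∈ Set.Ioo (0 : ℝ) 1,
      1 / x = Real.log (1 - tstar) + tstar / (1 - tstar) ∧
      (∀ s ∈ Set.Ioo (0 : ℝ) 1, 1 / x = Real.log (1 - s) + s / (1 - s) → s = tstar) ∧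
      (∀ t ∈ Set.Ioo (0 : ℝ) 1, g x tstar ≤ g x t) ∧
      (∀ t ∈ Set.Ioo (0 : ℝ) 1, t ≠ tstar → g x tstar < g x t) ∧
      tstar ≤ Real.sqrt (2 / x) := by
  have hx0 : 0 < x := by linarith
  obtain ⟨r, hr, hfoc⟩ := exists_first_order_condition (one_div_pos.2 hx0)
    ((div_le_one hx0).2 hx)
  have hmin : ∀ t ∈ Set.Ioo (0 : ℝ) 1, t ≠ r → g x r < g x t := fun t ht hne =>
    g_lt_of_first_order_condition hx0 hr hfoc ht hne
  refine ⟨r, hr, hfoc, fun s hs hsfoc => ?_, fun t ht => ?_, hmin, ?_⟩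
  · by_contra hne
    exact lt_asymm (hmin s hs hne)
      (g_lt_of_first_order_condition hx0 hs hsfoc hr (Ne.symm hne))
  · rcases eq_or_ne t r with rfl | hne
    · exact le_rfl
    · exact (hmin t ht hne).le
  · have hsq := sq_div_two_le_log_one_sub_add hr.1.le hr.2
    rw [← hfoc] at hsq
    have hx2 : 2 / x = 2 * (1 / x) := by ring
    exact Real.le_sqrt_of_sq_le (by linarith)
end

section
/- Let g(x,t) = 1/t + (x/t)·log(1/(1−t)) for x ≥ 1 and t ∈ (0,1), and let G(x) = inf_{0<t<1} g(x,t). Then there exists a constant C such that |G(x) − x − √(2x) − 1/2| ≤ C for all x ≥ 1; equivalently G(x) = (√x + 2^{−1/2})²·(1 + O(1/x)) as x → ∞. -/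
open Set

theorem add_sq_div_two_le_log_one_div {t : ℝ} (h0 : 0 < t) (h1 : t < 1) :
    t + t ^ 2 / 2 ≤ Real.log (1 / (1 - t)) := by
  have hs := Real.hasSum_pow_div_log_of_abs_lt_one (x := t) (by rwa [abs_of_pos h0])
  have := sum_le_hasSum (Finset.range 2) (fun i _ => by positivity) hs
  rw [one_div, Real.log_inv]
  norm_num [Finset.sum_range_succ] at this
  linarith

theorem log_le_half_sub_inv_s12 {u : ℝ} (hu : 1 ≤ u) : Real.log u ≤ (u - u⁻¹) / 2 := by
  rw [← Real.sinh_log (by positivity)]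
  exact Real.self_le_sinh_iff.2 (Real.log_nonneg hu)

theorem add_sqrt_two_mul_le_g {x t : ℝ} (hx : 0 ≤ x) (h0 : 0 < t) (h1 : t < 1) :
    x + Real.sqrt (2 * x) ≤ g x t := by
  have hsq : Real.sqrt (2 * x) ^ 2 = 2 * x := Real.sq_sqrt (by positivity)
  have hlog : x / t * (t + t ^ 2 / 2) ≤ x / t * Real.log (1 / (1 - t)) :=
    mul_le_mul_of_nonneg_left (add_sq_div_two_le_log_one_div h0 h1) (by positivity)
  have hamgm : 1 / t + x / t * (t + t ^ 2 / 2) - (x + Real.sqrt (2 * x))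
      = (Real.sqrt (2 * x) * t - 2) ^ 2 / (4 * t) := by
    rw [sub_sq, mul_pow, hsq]
    field_simp
    ring
  have : 0 ≤ (Real.sqrt (2 * x) * t - 2) ^ 2 / (4 * t) := by positivity
  unfold g
  linarith

/-- The near-optimal choice `t = 2 / (s + 1)` with `s = √(2x)`. -/
theorem g_two_div_add_one_le {s : ℝ} (hs : 1 < s) :
    g (s ^ 2 / 2) (2 / (s + 1)) ≤ s ^ 2 / 2 + s + 1 + 1 / (2 * (s - 1)) := by
  have hs1 : 0 < s - 1 := by linarith
  have hs2 : 0 < s + 1 := by linarith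
  have hu : 1 / (1 - 2 / (s + 1)) = (s + 1) / (s - 1) := by
    have : 1 - 2 / (s + 1) = (s - 1) / (s + 1) := by
      field_simp
      ring
    rw [this, one_div_div]
  have hlog := log_le_half_sub_inv_s12 (u := (s + 1) / (s - 1)) (by rw [le_div_iff₀ hs1]; linarith)
  unfold g
  rw [hu]
  calc _ ≤ 1 / (2 / (s + 1)) + s ^ 2 / 2 / (2 / (s + 1)) *
        (((s + 1) / (s - 1) - ((s + 1) / (s - 1))⁻¹) / 2) := by gcongr
    _ = _ := by
      field_simp
      ring

/-- `G(x) = x + √(2x) + 1/2 + O(1)`, i.e. `G(x) = (√x + 2^{−1/2})²·(1 + O(1/x))`. -/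
theorem G_asymptotics :
    ∃ C : ℝ, ∀ x : ℝ, 1 ≤ x → |G x - x - Real.sqrt (2 * x) - 1 / 2| ≤ C := by
  refine ⟨2, fun x hx => ?_⟩
  have hx0 : 0 ≤ x := by linarith
  have hlower : ∀ y ∈ (fun t => g x t) '' Ioo (0 : ℝ) 1, x + Real.sqrt (2 * x) ≤ y := by
    rintro _ ⟨t, ⟨h0, h1⟩, rfl⟩
    exact add_sqrt_two_mul_le_g hx0 h0 h1
  have hlow : x + Real.sqrt (2 * x) ≤ G x :=
    le_csInf ((nonempty_Ioo.2 one_pos).image _) hlower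
  have hs : 7 / 5 ≤ Real.sqrt (2 * x) := Real.le_sqrt_of_sq_le (by linarith)
  have hsq : Real.sqrt (2 * x) ^ 2 / 2 = x := by
    rw [Real.sq_sqrt (by positivity)]
    ring
  have hup := g_two_div_add_one_le (s := Real.sqrt (2 * x)) (by linarith)
  rw [hsq] at hup
  have hG : G x ≤ g x (2 / (Real.sqrt (2 * x) + 1)) :=
    csInf_le ⟨_, hlower⟩ ⟨_, ⟨by positivity, by rw [div_lt_one (by positivity)]; linarith⟩, rfl⟩
  have herr : 1 / (2 * (Real.sqrt (2 * x) - 1)) ≤ 3 / 2 := by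
    rw [div_le_iff₀ (by linarith)]
    linarith
  rw [abs_le]
  constructor <;> linarith
end

section
/- Let g(x,t) = 1/t + (x/t)·log(1/(1−t)) for x ≥ 1 and t ∈ (0,1), let G(x) = inf_{0<t<1} g(x,t), let H(x) ∈ (0,1) denote the unique minimizer of t ↦ g(x,t), and define β by β(1) = 1, β(n+1) = G(β(n)), and the thresholds by t₁ = 1 and t_{n+1} = H(β(n)) for n ≥ 1. Then there exists a constant C such that |t_n − 2/n| ≤ C·(log n)/n² for all n ≥ 2. -/
open Set

/-- The minimizer `t` of `g x` is characterised by `optGap t = 1 / x`. -/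
noncomputable def optGap (t : ℝ) : ℝ := t / (1 - t) + Real.log (1 - t)

theorem hasDerivAt_g (x : ℝ) {t : ℝ} (h0 : 0 < t) (h1 : t < 1) :
    HasDerivAt (g x) ((x * optGap t - 1) / t ^ 2) t := by
  have ht : (1 - t) ≠ 0 := by linarith
  have hlog : HasDerivAt (fun s : ℝ => Real.log (1 - s)) (-1 / (1 - t)) t :=
    ((hasDerivAt_id t).const_sub 1).log ht
  have h := ((hlog.const_mul x).const_sub 1).div (hasDerivAt_id t) h0.ne'
  have hg : g x = (fun s : ℝ => 1 - x * Real.log (1 - s)) / id := by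
    funext s
    simp only [g, one_div, Real.log_inv, Pi.div_apply, id]
    ring
  rw [hg]
  refine h.congr_deriv ?_
  simp only [optGap, id]
  field_simp
  ring

theorem optGap_eq_of_minimizer {x t : ℝ} (hx : 0 < x) (ht : t ∈ Ioo (0 : ℝ) 1)
    (hmin : ∀ s ∈ Ioo (0 : ℝ) 1, g x t ≤ g x s) : optGap t = 1 / x := by
  have hloc : IsLocalMin (g x) t := by
    filter_upwards [Ioo_mem_nhds ht.1 ht.2] with s hs using hmin s hs
  have h := hloc.hasDerivAt_eq_zero (hasDerivAt_g x ht.1 ht.2)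
  have ht2 : t ^ 2 ≠ 0 := pow_ne_zero _ ht.1.ne'
  rw [div_eq_zero_iff, or_iff_left ht2] at h
  field_simp
  linarith

theorem G_eq_of_minimizer {x t : ℝ} (hx : 0 < x) (ht : t ∈ Ioo (0 : ℝ) 1)
    (hmin : ∀ s ∈ Ioo (0 : ℝ) 1, g x t ≤ g x s) : G x = x / (1 - t) := by
  have hG : G x = g x t := by
    refine IsLeast.csInf_eq ⟨mem_image_of_mem _ ht, ?_⟩
    rintro _ ⟨s, hs, rfl⟩
    exact hmin s hs
  have h := optGap_eq_of_minimizer hx ht hmin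
  have h0 := ht.1.ne'
  have h1 : (1 - t) ≠ 0 := by linarith [ht.2]
  have hlog : Real.log (1 - t) = 1 / x - t / (1 - t) := by
    simp only [optGap] at h
    linarith
  rw [hG]
  simp only [g, one_div (1 - t), Real.log_inv, hlog]
  field_simp
  ring

theorem sq_inv_sqrt_sub_one_le_optGap {t : ℝ} (h1 : t < 1) :
    (1 / √(1 - t) - 1) ^ 2 ≤ optGap t := by
  have hpos : 0 < 1 - t := by linarith
  have hq : 0 < √(1 - t) := Real.sqrt_pos.2 hpos
  have hsq : √(1 - t) ^ 2 = 1 - t := Real.sq_sqrt hpos.le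
  have hl := Real.one_sub_inv_le_log_of_pos hq
  rw [Real.log_sqrt hpos.le] at hl
  have hfrac : t / (1 - t) = (1 / √(1 - t)) ^ 2 - 1 := by
    rw [div_pow, hsq]
    field_simp
    ring
  rw [optGap, hfrac]
  rw [inv_eq_one_div] at hl
  linarith

theorem sq_div_four_le_optGap {t : ℝ} (h0 : 0 ≤ t) (h1 : t < 1) : t ^ 2 / 4 ≤ optGap t := by
  refine le_trans ?_ (sq_inv_sqrt_sub_one_le_optGap h1)
  have hpos : 0 < 1 - t := by linarith
  have hq : 0 < √(1 - t) := Real.sqrt_pos.2 hpos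
  have hsq : √(1 - t) ^ 2 = 1 - t := Real.sq_sqrt hpos.le
  have hq1 : √(1 - t) ≤ 1 := Real.sqrt_le_one.2 (by linarith)
  have h : t / 2 ≤ 1 / √(1 - t) - 1 := by
    have : t / 2 + 1 ≤ 1 / √(1 - t) := by
      rw [le_div_iff₀ hq]
      nlinarith
    linarith
  calc t ^ 2 / 4 = (t / 2) ^ 2 := by ring
    _ ≤ _ := by gcongr

theorem le_three_quarters_of_optGap_le_one {t : ℝ} (h1 : t < 1) (h : optGap t ≤ 1) :
    t ≤ 3 / 4 := by
  have hpos : 0 < 1 - t := by linarith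
  have hq : 0 < √(1 - t) := Real.sqrt_pos.2 hpos
  have hsq : √(1 - t) ^ 2 = 1 - t := Real.sq_sqrt hpos.le
  have h2 := (sq_inv_sqrt_sub_one_le_optGap h1).trans h
  have h3 : 1 / √(1 - t) ≤ 2 := by nlinarith
  rw [div_le_iff₀ hq] at h3
  nlinarith

theorem optGap_le_four_mul_sq {t : ℝ} (h : t ≤ 3 / 4) : optGap t ≤ 4 * t ^ 2 := by
  have hpos : 0 < 1 - t := by linarith
  have hl := Real.log_le_sub_one_of_pos hpos
  have : t / (1 - t) - t ≤ 4 * t ^ 2 := by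
    have he : t / (1 - t) - t = t ^ 2 / (1 - t) := by field_simp; ring
    rw [he, div_le_iff₀ hpos]
    nlinarith [sq_nonneg t]
  rw [optGap]
  linarith

theorem optGap_mono {a b : ℝ} (h0 : 0 ≤ a) (hab : a ≤ b) (h1 : b < 1) :
    optGap a ≤ optGap b := by
  have ha : 0 < 1 - a := by linarith
  have hb : 0 < 1 - b := by linarith
  have hl := Real.log_le_sub_one_of_pos (div_pos ha hb)
  rw [Real.log_div ha.ne' hb.ne'] at hl
  have he : b / (1 - b) - a / (1 - a) - ((1 - a) / (1 - b) - 1)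
      = a * (b - a) / ((1 - a) * (1 - b)) := by
    field_simp
    ring
  have : 0 ≤ a * (b - a) / ((1 - a) * (1 - b)) :=
    div_nonneg (mul_nonneg h0 (by linarith)) (mul_pos ha hb).le
  simp only [optGap]
  linarith

theorem optGap_sub_le {a b : ℝ} (h0 : 0 ≤ a) (hab : a ≤ b) (h1 : b ≤ 3 / 4) :
    optGap b - optGap a ≤ 16 * b * (b - a) := by
  have ha : 0 < 1 - a := by linarith
  have hb : 0 < 1 - b := by linarith
  have hl := Real.log_le_sub_one_of_pos (div_pos hb ha)
  rw [Real.log_div hb.ne' ha.ne'] at hl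
  have he : b / (1 - b) - a / (1 - a) + ((1 - b) / (1 - a) - 1)
      = b * (b - a) / ((1 - a) * (1 - b)) := by
    field_simp
    ring
  have h2 : b * (b - a) / ((1 - a) * (1 - b)) ≤ 16 * b * (b - a) := by
    rw [div_le_iff₀ (mul_pos ha hb)]
    have h3 : 1 ≤ 16 * ((1 - a) * (1 - b)) := by nlinarith
    have h4 : 0 ≤ b * (b - a) := mul_nonneg (by linarith) (by linarith)
    nlinarith
  simp only [optGap]
  linarith

theorem abs_optGap_sub_le {t : ℝ} (h0 : 0 ≤ t) (h1 : t ≤ 3 / 4) :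
    |optGap t - (t ^ 2 / 2 + 2 * t ^ 3 / 3)| ≤ 8 * t ^ 4 := by
  have hpos : 0 < 1 - t := by linarith
  have h := Real.abs_log_sub_add_sum_range_le (x := t) (by rw [abs_of_nonneg h0]; linarith) 3
  rw [abs_of_nonneg h0] at h
  simp only [Finset.sum_range_succ, Finset.sum_range_zero] at h
  have h4 : t ^ 4 / (1 - t) ≤ 4 * t ^ 4 := by
    rw [div_le_iff₀ hpos]
    nlinarith [pow_nonneg h0 4]
  have h5 : 0 ≤ t ^ 4 / (1 - t) := by positivity
  have he : t / (1 - t) = t + t ^ 2 + t ^ 3 + t ^ 4 / (1 - t) := by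
    field_simp
    ring
  norm_num at h
  rw [abs_le] at h ⊢
  rw [optGap, he]
  constructor <;> linarith [h.1, h.2]

section Recursion

variable {a s : ℝ}

theorem le_of_optGap_eq_one_sub_mul (ha1 : a < 1) (hs0 : 0 < s) (hs1 : s < 1)
    (h : optGap a = (1 - s) * optGap s) : a ≤ s := by
  by_contra! hlt
  have h1 := optGap_mono hs0.le hlt.le ha1
  have h2 := sq_div_four_le_optGap hs0.le hs1
  have h3 : 0 < s ^ 2 := by positivity
  nlinarith

theorem div_eight_le_of_optGap_eq (ha0 : 0 < a) (ha1 : a ≤ 3 / 4) (hs0 : 0 < s)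
    (hs1 : s ≤ 3 / 4) (h : optGap a = (1 - s) * optGap s) : s / 8 ≤ a := by
  have h1 := optGap_le_four_mul_sq ha1
  have h2 := sq_div_four_le_optGap hs0.le (by linarith)
  have h3 : (s / 8) ^ 2 ≤ a ^ 2 := by nlinarith [sq_nonneg s]
  exact le_of_sq_le_sq h3 ha0.le

theorem sq_div_le_sub_of_optGap_eq (ha0 : 0 < a) (hs0 : 0 < s)
    (hs1 : s ≤ 3 / 4) (has : a ≤ s) (h : optGap a = (1 - s) * optGap s) :
    s ^ 2 / 64 ≤ s - a := by
  have h1 := optGap_sub_le ha0.le has hs1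
  have h2 := sq_div_four_le_optGap hs0.le (by linarith)
  have h3 : s * (s ^ 2 / 4) ≤ s * (16 * (s - a)) := by nlinarith
  have h4 := le_of_mul_le_mul_left h3 hs0
  linarith

theorem abs_sub_sub_sq_div_two_le (ha0 : 0 < a) (ha1 : a ≤ 3 / 4) (hs0 : 0 < s)
    (hs1 : s ≤ 3 / 4) (has : a ≤ s) (h : optGap a = (1 - s) * optGap s) :
    s - a ≤ 28 * s ^ 2 ∧ |s - a - s ^ 2 / 2| ≤ 465 * s ^ 3 := by
  have hea := abs_le.1 (abs_optGap_sub_le ha0.le ha1)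
  have hes := abs_le.1 (abs_optGap_sub_le hs0.le hs1)
  have ha4 : a ^ 4 ≤ s ^ 4 := by gcongr
  have ha3 : a ^ 3 ≤ s ^ 3 := by gcongr
  have hs4 : 0 < s ^ 4 := by positivity
  have hs3 : 0 < s ^ 3 := by positivity
  have hs43 : s ^ 4 ≤ 3 / 4 * s ^ 3 := by nlinarith
  have hlo : s ^ 2 / 2 + s ^ 3 / 6 - 17 * s ^ 4 ≤ a ^ 2 / 2 + 2 * a ^ 3 / 3 := by
    have : (1 - s) * (s ^ 2 / 2 + 2 * s ^ 3 / 3 - 8 * s ^ 4) ≤ (1 - s) * optGap s :=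
      mul_le_mul_of_nonneg_left (by linarith [hes.1]) (by linarith)
    nlinarith [hea.2, mul_pos hs0 hs4]
  have hhi : a ^ 2 / 2 + 2 * a ^ 3 / 3 ≤ s ^ 2 / 2 + s ^ 3 / 6 + 17 * s ^ 4 := by
    have : (1 - s) * optGap s ≤ (1 - s) * (s ^ 2 / 2 + 2 * s ^ 3 / 3 + 8 * s ^ 4) :=
      mul_le_mul_of_nonneg_left (by linarith [hes.2]) (by linarith)
    nlinarith [hea.1, mul_pos hs0 hs4]
  have hd : s - a ≤ 28 * s ^ 2 := by
    have h1 : s * (s - a) ≤ s * (28 * s ^ 2) := by nlinarith [mul_nonneg ha0.le (sub_nonneg.2 has)]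
    exact le_of_mul_le_mul_left h1 hs0
  refine ⟨hd, ?_⟩
  have hd0 : 0 ≤ s - a := by linarith
  have hcube : s ^ 3 - a ^ 3 ≤ 84 * s ^ 4 := by
    have h1 : s ^ 2 + s * a + a ^ 2 ≤ 3 * s ^ 2 := by nlinarith
    calc s ^ 3 - a ^ 3 = (s - a) * (s ^ 2 + s * a + a ^ 2) := by ring
      _ ≤ (28 * s ^ 2) * (3 * s ^ 2) := by gcongr
      _ = 84 * s ^ 4 := by ring
  have hd2 : (s - a) ^ 2 ≤ 784 * s ^ 4 := by
    calc (s - a) ^ 2 ≤ (28 * s ^ 2) ^ 2 := by gcongr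
      _ = 784 * s ^ 4 := by ring
  have hexp : s * (s - a) = (s ^ 2 - a ^ 2) / 2 + (s - a) ^ 2 / 2 := by ring
  rw [abs_le]
  constructor
  · have h1 : s * (-(465 * s ^ 3)) ≤ s * (s - a - s ^ 2 / 2) := by
      nlinarith [sq_nonneg (s - a)]
    exact le_of_mul_le_mul_left h1 hs0
  · have h1 : s * (s - a - s ^ 2 / 2) ≤ s * (465 * s ^ 3) := by
      nlinarith [sq_nonneg (s - a)]
    exact le_of_mul_le_mul_left h1 hs0

theorem inv_add_le_inv_of_optGap_eq (ha0 : 0 < a) (hs0 : 0 < s)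
    (hs1 : s ≤ 3 / 4) (has : a ≤ s) (h : optGap a = (1 - s) * optGap s) :
    s⁻¹ + 1 / 64 ≤ a⁻¹ := by
  have h1 := sq_div_le_sub_of_optGap_eq ha0 hs0 hs1 has h
  have he : a⁻¹ - s⁻¹ - 1 / 64 = (s - a - s * a / 64) / (s * a) := by
    field_simp
  have : 0 ≤ (s - a - s * a / 64) / (s * a) :=
    div_nonneg (by nlinarith) (by positivity)
  linarith

theorem abs_inv_sub_inv_sub_half_le (ha0 : 0 < a) (ha1 : a ≤ 3 / 4) (hs0 : 0 < s)
    (hs1 : s ≤ 3 / 4) (has : a ≤ s) (h : optGap a = (1 - s) * optGap s) :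
    |a⁻¹ - s⁻¹ - 1 / 2| ≤ 4000 * s := by
  obtain ⟨hd, hq⟩ := abs_sub_sub_sq_div_two_le ha0 ha1 hs0 hs1 has h
  have h8 := div_eight_le_of_optGap_eq ha0 ha1 hs0 hs1 h
  have he : a⁻¹ - s⁻¹ - 1 / 2 = (s - a - s ^ 2 / 2 + s * (s - a) / 2) / (s * a) := by
    field_simp
    ring
  have hsd : s * (s - a) ≤ s * (28 * s ^ 2) := mul_le_mul_of_nonneg_left hd hs0.le
  have hsd0 : 0 ≤ s * (s - a) := mul_nonneg hs0.le (by linarith)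
  have hs3 : 0 < s ^ 3 := by positivity
  have hden : s ^ 3 / 8 ≤ s * (s * a) := by nlinarith [sq_nonneg s]
  rw [he, abs_div, abs_of_pos (mul_pos hs0 ha0), div_le_iff₀ (mul_pos hs0 ha0)]
  rw [abs_le] at hq ⊢
  constructor <;> nlinarith [hq.1, hq.2]

end Recursion

theorem abs_sub_half_le_log {u : ℕ → ℝ} (h1 : 1 ≤ u 1) (h2 : u 1 ≤ 2)
    (hstep : ∀ n, 1 ≤ n → u n + 1 / 64 ≤ u (n + 1))
    (herr : ∀ n, 1 ≤ n → |u (n + 1) - u n - 1 / 2| ≤ 4000 * (u n)⁻¹) :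
    ∀ n : ℕ, 1 ≤ n → (n : ℝ) / 64 ≤ u n ∧ |u n - n / 2| ≤ 512000 * (1 + Real.log n) := by
  intro n hn
  induction n, hn using Nat.le_induction with
  | base =>
    norm_num
    refine ⟨by linarith, ?_⟩
    rw [abs_le]
    constructor <;> linarith
  | succ n hn ih =>
    have hn1 : (1 : ℝ) ≤ n := by exact_mod_cast hn
    have hn0 : (0 : ℝ) < n := by linarith
    refine ⟨?_, ?_⟩
    · push_cast
      linarith [hstep n hn, ih.1]
    · have hinv : (u n)⁻¹ ≤ 64 / n := by
        rw [inv_le_comm₀ (by linarith [div_pos hn0 (by norm_num : (0 : ℝ) < 64)]) (by positivity),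
          inv_div]
        exact ih.1
      have hlog : 1 / (2 * (n : ℝ)) ≤ Real.log (n + 1) - Real.log n := by
        have h := Real.one_sub_inv_le_log_of_pos (x := ((n : ℝ) + 1) / n) (by positivity)
        rw [Real.log_div (by positivity) hn0.ne', inv_div] at h
        have h3 : 1 - (n : ℝ) / (n + 1) = 1 / (n + 1) := by field_simp; ring
        have h4 : 1 / (2 * (n : ℝ)) ≤ 1 / (n + 1) :=
          one_div_le_one_div_of_le (by positivity) (by linarith)
        linarith
      have h5 : 64 / (n : ℝ) = 128 * (1 / (2 * n)) := by field_simp; norm_num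
      have e := abs_le.1 (herr n hn)
      have i := abs_le.1 ih.2
      push_cast
      rw [abs_le]
      constructor <;> linarith [e.1, e.2, i.1, i.2]

theorem one_le_beta_succ (H : ℝ → ℝ)
    (hH : ∀ x : ℝ, 1 ≤ x →
      H x ∈ Set.Ioo (0 : ℝ) 1 ∧ ∀ t ∈ Set.Ioo (0 : ℝ) 1, g x (H x) ≤ g x t) (n : ℕ) :
    1 ≤ beta (n + 1) := by
  induction n with
  | zero => simp [beta]
  | succ n ih =>
    obtain ⟨hm, hmin⟩ := hH _ ih
    rw [beta, G_eq_of_minimizer (by linarith) hm hmin, le_div_iff₀ (by linarith [hm.2])]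
    linarith [hm.1]

/-- If `H x` is the unique minimizer of `t ↦ g x t` over `(0,1)`, and the thresholds are
`t₁ = 1`, `t_{n+1} = H (β n)` for `n ≥ 1`, then `t_n = 2/n + O(n^{−2} log n)`. -/
theorem threshold_asymptotics (H : ℝ → ℝ)
    (hH : ∀ x : ℝ, 1 ≤ x →
      H x ∈ Set.Ioo (0 : ℝ) 1 ∧ ∀ t ∈ Set.Ioo (0 : ℝ) 1, g x (H x) ≤ g x t)
    (tseq : ℕ → ℝ) (ht1 : tseq 1 = 1)
    (htrec : ∀ n : ℕ, 1 ≤ n → tseq (n + 1) = H (beta n)) :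
    ∃ C : ℝ, ∀ n : ℕ, 2 ≤ n →
      |tseq n - 2 / (n : ℝ)| ≤ C * Real.log n / (n : ℝ) ^ 2 := by
  have hβ : ∀ n, 1 ≤ n → 1 ≤ beta n := by
    intro n hn
    obtain ⟨m, rfl⟩ := Nat.exists_eq_add_of_le' hn
    exact one_le_beta_succ H hH m
  have hmem : ∀ n, 1 ≤ n → H (beta n) ∈ Ioo (0 : ℝ) 1 := fun n hn => (hH _ (hβ n hn)).1
  have hgap : ∀ n, 1 ≤ n → optGap (H (beta n)) = 1 / beta n := fun n hn =>
    optGap_eq_of_minimizer (by linarith [hβ n hn]) (hmem n hn) (hH _ (hβ n hn)).2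
  have hle : ∀ n, 1 ≤ n → H (beta n) ≤ 3 / 4 := by
    intro n hn
    refine le_three_quarters_of_optGap_le_one (hmem n hn).2 ?_
    rw [hgap n hn, div_le_one (by linarith [hβ n hn])]
    exact hβ n hn
  have hrec : ∀ n, 1 ≤ n →
      optGap (H (beta (n + 1))) = (1 - H (beta n)) * optGap (H (beta n)) := by
    intro n hn
    have hG : beta (n + 1) = G (beta n) := by
      obtain ⟨m, rfl⟩ := Nat.exists_eq_add_of_le' hn
      rfl
    rw [hgap _ (by omega), hgap n hn, hG,
      G_eq_of_minimizer (by linarith [hβ n hn]) (hmem n hn) (hH _ (hβ n hn)).2]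
    field_simp
  have hanti : ∀ n, 1 ≤ n → H (beta (n + 1)) ≤ H (beta n) := fun n hn =>
    le_of_optGap_eq_one_sub_mul (hmem _ (by omega)).2 (hmem n hn).1
      (hmem n hn).2 (hrec n hn)
  have hu := abs_sub_half_le_log (u := fun n => (H (beta n))⁻¹)
    (by
      have h := hmem 1 le_rfl
      exact (one_le_inv₀ h.1).2 h.2.le)
    (by
      have h := hmem 1 le_rfl
      have h4 := optGap_le_four_mul_sq (hle 1 le_rfl)
      rw [hgap 1 le_rfl] at h4
      simp only [beta] at h h4 ⊢
      rw [inv_le_comm₀ h.1 (by norm_num)]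
      nlinarith [h.1])
    (fun n hn => inv_add_le_inv_of_optGap_eq (hmem _ (by omega)).1 (hmem n hn).1 (hle n hn)
      (hanti n hn) (hrec n hn))
    (fun n hn => by
      simpa only [inv_inv] using abs_inv_sub_inv_sub_half_le (hmem _ (by omega)).1
        (hle _ (by omega)) (hmem n hn).1 (hle n hn) (hanti n hn) (hrec n hn))
  refine ⟨256 * 1536001, fun n hn => ?_⟩
  obtain ⟨m, rfl⟩ : ∃ m, n = m + 1 := ⟨n - 1, by omega⟩
  have hm : 1 ≤ m := by omega
  obtain ⟨hlow, hdev⟩ := hu m hm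
  rw [htrec m hm]
  have hs0 := (hmem m hm).1
  set s := H (beta m)
  have hm1 : (1 : ℝ) ≤ m := by exact_mod_cast hm
  push_cast
  have hlogm : Real.log m ≤ Real.log (m + 1) := Real.log_le_log (by linarith) (by linarith)
  have hlog2 : 1 ≤ 2 * Real.log (m + 1) := by
    have h := Real.log_le_log (by norm_num : (0 : ℝ) < 2) (by linarith : (2 : ℝ) ≤ m + 1)
    linarith [Real.log_two_gt_d9]
  have hdev' : |s⁻¹ - (m + 1) / 2| ≤ 1536001 * Real.log (m + 1) := by
    rw [abs_le] at hdev ⊢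
    constructor <;> linarith [hdev.1, hdev.2]
  have hs : s ≤ 128 / (m + 1) := by
    have h : ((m : ℝ) + 1) / 128 ≤ s⁻¹ := by linarith
    rw [le_inv_comm₀ (by positivity) hs0, inv_div] at h
    exact h
  have he : s - 2 / (m + 1) = -(s * (2 / (m + 1)) * (s⁻¹ - (m + 1) / 2)) := by
    field_simp
    ring
  rw [he, abs_neg, abs_mul, abs_of_pos (by positivity)]
  calc s * (2 / (m + 1)) * |s⁻¹ - (m + 1) / 2|
      ≤ 128 / (m + 1) * (2 / (m + 1)) * (1536001 * Real.log (m + 1)) := by gcongr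
    _ = 256 * 1536001 * Real.log (m + 1) / (m + 1) ^ 2 := by
      field_simp
      ring
end

section
/- Fix α > 2 and a constant C > 0. Suppose v : ℕ → ℝ is a sequence such that for every n ≥ 2 one has v(n) = (1 + 2/n + ε_n)·v(n−1) + (1/3)·n² + δ_n, where |ε_n| ≤ C·(log n)/n² and |δ_n| ≤ C·n·log n. Then there exists a constant C' such that |v(n) − (1/3)·n²·(n+1)| ≤ C'·n²·(log n)^α for all n ≥ 2; in particular v(n) = (1/3)·n³ + O(n²·(log n)^α). -/
/-- The series `∑ log n / n²` converges. -/
theorem summable_log_div_sq : Summable fun n : ℕ => Real.log n / (n : ℝ) ^ 2 := by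
  have hs : Summable fun n : ℕ => 2 * (1 / (n : ℝ) ^ (3 / 2 : ℝ)) :=
    (Real.summable_one_div_nat_rpow.mpr (by norm_num)).mul_left 2
  refine Summable.of_nonneg_of_le
    (fun n => div_nonneg (Real.log_natCast_nonneg n) (by positivity)) (fun n => ?_) hs
  rcases Nat.eq_zero_or_pos n with rfl | hn
  · simp
  have hn' : (0 : ℝ) < n := by exact_mod_cast hn
  have hlog := Real.log_le_rpow_div hn'.le (show (0 : ℝ) < 1 / 2 by norm_num)
  have hpow : (n : ℝ) ^ 2 = (n : ℝ) ^ (3 / 2 : ℝ) * (n : ℝ) ^ (1 / 2 : ℝ) := by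
    rw [← Real.rpow_add hn', ← Real.rpow_natCast]
    norm_num
  have h₁ : (0 : ℝ) < (n : ℝ) ^ (3 / 2 : ℝ) := by positivity
  have h₂ : (0 : ℝ) < (n : ℝ) ^ (1 / 2 : ℝ) := by positivity
  calc Real.log n / (n : ℝ) ^ 2 ≤ (n : ℝ) ^ (1 / 2 : ℝ) / (1 / 2) / (n : ℝ) ^ 2 := by gcongr
    _ = 2 * (1 / (n : ℝ) ^ (3 / 2 : ℝ)) := by
      rw [hpow]
      field_simp

/-- The discrete increment of `log²` dominates `log x / x`. -/
theorem log_add_one_div_le_sq_sub_sq {x : ℝ} (hx : 1 ≤ x) :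
    Real.log (x + 1) / (x + 1) ≤ Real.log (x + 1) ^ 2 - Real.log x ^ 2 := by
  have hx₀ : 0 < x := by linarith
  have h₁ : 1 / (x + 1) ≤ Real.log (x + 1) - Real.log x := by
    have h := Real.one_sub_inv_le_log_of_pos (show 0 < (x + 1) / x by positivity)
    rw [Real.log_div (by positivity) hx₀.ne'] at h
    have h' : 1 - ((x + 1) / x)⁻¹ = 1 / (x + 1) := by
      field_simp
      ring
    linarith
  have h₂ : 0 ≤ Real.log x := Real.log_nonneg hx
  have h₃ : 0 ≤ Real.log (x + 1) := Real.log_nonneg (by linarith)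
  have h₄ : 0 ≤ 1 / (x + 1) := by positivity
  rw [div_eq_mul_one_div]
  nlinarith [mul_le_mul_of_nonneg_left h₁ h₃, mul_nonneg h₂ (h₄.trans h₁)]

/-- A discrete Grönwall inequality with forcing term `K · log n / n`. -/
theorem le_exp_sum_mul_of_log_div_recursion {u e : ℕ → ℝ} {K : ℝ} (hK : 0 ≤ K)
    (he : ∀ n, 0 ≤ e n) (hu₁ : 0 ≤ u 1)
    (hu : ∀ n : ℕ, 1 ≤ n → u (n + 1) ≤
      (1 + e (n + 1)) * u n + K * (Real.log ((n : ℝ) + 1) / ((n : ℝ) + 1)))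
    (n : ℕ) (hn : 1 ≤ n) :
    u n ≤ Real.exp (∑ k ∈ Finset.range (n + 1), e k) * (u 1 + K * Real.log n ^ 2) := by
  have hexp : ∀ m : ℕ, 1 ≤ Real.exp (∑ k ∈ Finset.range m, e k) := fun m =>
    Real.one_le_exp (Finset.sum_nonneg fun k _ => he k)
  induction n, hn using Nat.le_induction with
  | base => simpa using mul_le_mul_of_nonneg_right (hexp 2) hu₁
  | succ n hn ih =>
    have hn' : (1 : ℝ) ≤ n := by exact_mod_cast hn
    have hstep := log_add_one_div_le_sq_sub_sq hn'
    have hforce : 0 ≤ K * (Real.log ((n : ℝ) + 1) / ((n : ℝ) + 1)) :=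
      mul_nonneg hK (div_nonneg (Real.log_nonneg (by linarith)) (by linarith))
    have hY : 0 ≤ u 1 + K * Real.log n ^ 2 := by positivity
    have h₁ : 1 + e (n + 1) ≤ Real.exp (e (n + 1)) := by
      linarith [Real.add_one_le_exp (e (n + 1))]
    have hpos : 0 ≤ 1 + e (n + 1) := by linarith [he (n + 1)]
    push_cast
    calc u (n + 1)
        ≤ (1 + e (n + 1)) * u n + K * (Real.log ((n : ℝ) + 1) / ((n : ℝ) + 1)) := hu n hn
      _ ≤ Real.exp (e (n + 1)) *
            (Real.exp (∑ k ∈ Finset.range (n + 1), e k) * (u 1 + K * Real.log n ^ 2)) +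
          Real.exp (∑ k ∈ Finset.range (n + 1 + 1), e k) *
            (K * (Real.log ((n : ℝ) + 1) / ((n : ℝ) + 1))) :=
        add_le_add
          ((mul_le_mul_of_nonneg_left ih hpos).trans
            (mul_le_mul_of_nonneg_right h₁ (by positivity)))
          (le_mul_of_one_le_left hforce (hexp _))
      _ = Real.exp (∑ k ∈ Finset.range (n + 1 + 1), e k) *
            (u 1 + K * Real.log n ^ 2 + K * (Real.log ((n : ℝ) + 1) / ((n : ℝ) + 1))) := by
        rw [Finset.sum_range_succ _ (n + 1), Real.exp_add]
        ring
      _ ≤ Real.exp (∑ k ∈ Finset.range (n + 1 + 1), e k) *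
            (u 1 + K * Real.log ((n : ℝ) + 1) ^ 2) := by
        refine mul_le_mul_of_nonneg_left ?_ (Real.exp_pos _).le
        nlinarith [mul_le_mul_of_nonneg_left hstep hK]

theorem half_lt_log_of_two_le {x : ℝ} (hx : 2 ≤ x) : 1 / 2 < Real.log x := by
  linarith [Real.log_two_gt_d9, Real.log_le_log (by norm_num) hx]

/-- One step of the recursion for the error `w = v - n²(n+1)/3`, normalized by `(n+1)(n+2)`:
here `x = n`, `a` and `b` are the old and the new value of `v`, and `L = log (n+1)`. -/
theorem normalized_error_step {C x a b ε δ L : ℝ} (hC : 0 < C) (hx : 1 ≤ x) (hL : 1 / 2 < L)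
    (hb : b = (1 + 2 / (x + 1) + ε) * a + 1 / 3 * (x + 1) ^ 2 + δ)
    (hε : |ε| ≤ C * L / (x + 1) ^ 2) (hδ : |δ| ≤ C * (x + 1) * L) :
    |b - 1 / 3 * (x + 1) ^ 2 * (x + 1 + 1)| / ((x + 2) * (x + 3)) ≤
      (1 + C * L / (x + 1) ^ 2) * (|a - 1 / 3 * x ^ 2 * (x + 1)| / ((x + 1) * (x + 2))) +
        (2 * C + 2) * (L / (x + 1)) := by
  set w := a - 1 / 3 * x ^ 2 * (x + 1) with hw
  set E := C * L / (x + 1) ^ 2 with hE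
  have hE₀ : 0 ≤ E := by positivity
  have hEx : E * (x + 1) ^ 2 = C * L := by
    rw [hE]
    field_simp
  have hsplit : b - 1 / 3 * (x + 1) ^ 2 * (x + 1 + 1) =
      (1 + 2 / (x + 1) + ε) * w + (ε * (1 / 3 * x ^ 2 * (x + 1)) + δ - (x + 1 / 3)) := by
    rw [hb, hw]
    field_simp
    ring
  have hcoef : |1 + 2 / (x + 1) + ε| ≤ (1 + 2 / (x + 1)) * (1 + E) := by
    have h₀ : 0 ≤ 2 / (x + 1) := by positivity
    calc |1 + 2 / (x + 1) + ε| ≤ |1 + 2 / (x + 1)| + |ε| := abs_add_le _ _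
      _ ≤ (1 + 2 / (x + 1)) + E := by
        rw [abs_of_nonneg (by positivity)]
        gcongr
      _ ≤ _ := by nlinarith [mul_nonneg h₀ hE₀]
  have hforce : |ε * (1 / 3 * x ^ 2 * (x + 1)) + δ - (x + 1 / 3)| ≤
      (2 * C + 2) * L * (x + 1) := by
    have h₁ : |ε * (1 / 3 * x ^ 2 * (x + 1))| ≤ C * L * (x + 1) := by
      rw [abs_mul, abs_of_nonneg (show 0 ≤ 1 / 3 * x ^ 2 * (x + 1) by positivity), ← hEx]
      calc |ε| * (1 / 3 * x ^ 2 * (x + 1)) ≤ E * ((x + 1) ^ 2 * (x + 1)) := by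
            gcongr
            nlinarith
        _ = _ := by ring
    have h₂ : |x + 1 / 3| ≤ 2 * L * (x + 1) := by
      rw [abs_of_nonneg (by positivity)]
      nlinarith
    have h₃ := abs_sub (ε * (1 / 3 * x ^ 2 * (x + 1)) + δ) (x + 1 / 3)
    have h₄ := abs_add_le (ε * (1 / 3 * x ^ 2 * (x + 1))) δ
    linarith
  have hmain : |b - 1 / 3 * (x + 1) ^ 2 * (x + 1 + 1)| ≤
      (1 + 2 / (x + 1)) * (1 + E) * |w| + (2 * C + 2) * L * (x + 1) := by
    rw [hsplit]
    refine (abs_add_le _ _).trans (add_le_add ?_ hforce)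
    rw [abs_mul]
    gcongr
  rw [div_le_iff₀ (by positivity)]
  refine hmain.trans ?_
  have h₁ : (1 + 2 / (x + 1)) * (1 + E) * |w| =
      (1 + E) * (|w| / ((x + 1) * (x + 2))) * ((x + 2) * (x + 3)) := by
    field_simp
    ring
  have h₂ : (2 * C + 2) * L * (x + 1) ≤
      (2 * C + 2) * (L / (x + 1)) * ((x + 2) * (x + 3)) := by
    have h : (2 * C + 2) * L * (x + 1) =
        (2 * C + 2) * (L / (x + 1)) * ((x + 1) * (x + 1)) := by
      field_simp
    rw [h]
    gcongr <;> linarith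
  linarith

/-- Deterministic solution of the approximate variance recursion: if
`v n = (1 + 2/n + ε_n)·v (n−1) + n²/3 + δ_n` with `|ε_n| ≤ C·(log n)/n²` and
`|δ_n| ≤ C·n·log n`, then for any `α > 2` one has
`v n = n²(n+1)/3 + O(n²·(log n)^α)`, so `v n = n³/3 + O(n²·(log n)^α)`. -/
theorem variance_recursion_asymptotics (α C : ℝ) (hα : 2 < α) (hC : 0 < C)
    (v ε δ : ℕ → ℝ)
    (hrec : ∀ n : ℕ, 2 ≤ n →
      v n = (1 + 2 / (n : ℝ) + ε n) * v (n - 1) + (1 / 3 : ℝ) * (n : ℝ) ^ 2 + δ n)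
    (hε : ∀ n : ℕ, 2 ≤ n → |ε n| ≤ C * Real.log n / (n : ℝ) ^ 2)
    (hδ : ∀ n : ℕ, 2 ≤ n → |δ n| ≤ C * (n : ℝ) * Real.log n) :
    ∃ C' : ℝ, ∀ n : ℕ, 2 ≤ n →
      |v n - (1 / 3 : ℝ) * (n : ℝ) ^ 2 * ((n : ℝ) + 1)| ≤
        C' * (n : ℝ) ^ 2 * Real.log n ^ α := by
  set u : ℕ → ℝ := fun n =>
    |v n - 1 / 3 * (n : ℝ) ^ 2 * ((n : ℝ) + 1)| / (((n : ℝ) + 1) * ((n : ℝ) + 2)) with hu_def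
  set e : ℕ → ℝ := fun n => C * Real.log n / (n : ℝ) ^ 2 with he_def
  have he : ∀ n, 0 ≤ e n := fun n =>
    div_nonneg (mul_nonneg hC.le (Real.log_natCast_nonneg n)) (by positivity)
  have hsum : Summable e := by
    simpa only [he_def, mul_div_assoc] using summable_log_div_sq.mul_left C
  have hu₁ : 0 ≤ u 1 := by positivity
  have hu : ∀ n : ℕ, 1 ≤ n → u (n + 1) ≤
      (1 + e (n + 1)) * u n + (2 * C + 2) * (Real.log ((n : ℝ) + 1) / ((n : ℝ) + 1)) := by
    intro n hn
    have hn' : (1 : ℝ) ≤ n := by exact_mod_cast hn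
    have hr := hrec (n + 1) (by omega)
    have h₁ := hε (n + 1) (by omega)
    have h₂ := hδ (n + 1) (by omega)
    rw [Nat.add_sub_cancel] at hr
    push_cast at hr h₁ h₂
    have h := normalized_error_step hC hn' (half_lt_log_of_two_le (by linarith)) hr h₁ h₂
    simp only [hu_def, he_def]
    push_cast
    convert h using 3 <;> ring
  set S := Real.exp (∑' k, e k)
  refine ⟨3 * (S * (4 * u 1 + (2 * C + 2))) * 2 ^ (α - 2), fun n hn => ?_⟩
  have hn' : (2 : ℝ) ≤ n := by exact_mod_cast hn
  have hL := half_lt_log_of_two_le hn'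
  set L := Real.log n
  have hL₀ : 0 < L := by linarith
  have hLα : L ^ 2 ≤ 2 ^ (α - 2) * L ^ α := by
    have h₁ : 1 ≤ (2 * L) ^ (α - 2) := Real.one_le_rpow (by linarith) (by linarith)
    have h₂ : L ^ α = L ^ (α - 2) * L ^ 2 := by
      rw [← Real.rpow_natCast L 2, ← Real.rpow_add hL₀]
      norm_num
    rw [Real.mul_rpow (by norm_num) hL₀.le] at h₁
    rw [h₂, ← mul_assoc]
    exact le_mul_of_one_le_left (by positivity) h₁
  have hun : u n ≤ S * (4 * u 1 + (2 * C + 2)) * L ^ 2 :=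
    calc u n ≤ Real.exp (∑ k ∈ Finset.range (n + 1), e k) * (u 1 + (2 * C + 2) * L ^ 2) :=
          le_exp_sum_mul_of_log_div_recursion (by linarith) he hu₁ hu n (by omega)
      _ ≤ S * ((4 * u 1 + (2 * C + 2)) * L ^ 2) := by
          gcongr
          · exact Real.exp_le_exp.mpr (hsum.sum_le_tsum _ fun k _ => he k)
          · nlinarith [mul_nonneg hu₁ (show 0 ≤ 4 * L ^ 2 - 1 by nlinarith)]
      _ = _ := by ring
  have hden : ((n : ℝ) + 1) * ((n : ℝ) + 2) ≤ 3 * (n : ℝ) ^ 2 := by nlinarith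
  calc |v n - (1 / 3 : ℝ) * (n : ℝ) ^ 2 * ((n : ℝ) + 1)|
      = u n * (((n : ℝ) + 1) * ((n : ℝ) + 2)) := by
        simp only [hu_def]
        field_simp
    _ ≤ (S * (4 * u 1 + (2 * C + 2)) * (2 ^ (α - 2) * L ^ α)) * (3 * (n : ℝ) ^ 2) := by
        refine mul_le_mul (hun.trans ?_) hden (by positivity) (by positivity)
        gcongr
    _ = _ := by ring
end

section
/- Let b : ℕ → ℝ be a function on the positive integers such that b(m·n) ≤ m²·b(n) for all positive integers m and n, and such that b(n)/n² → 1/2 as n → ∞. Then (1/2)·n² ≤ b(n) for all n ≥ 1. -/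
open Filter

/-- If `b(m·n) ≤ m²·b(n)` for all positive integers `m, n` and `b(n)/n² → 1/2`,
then `n²/2 ≤ b(n)` for all `n ≥ 1`. -/
theorem blocking_lower_bound (b : ℕ → ℝ)
    (hb : ∀ m n : ℕ, 1 ≤ m → 1 ≤ n → b (m * n) ≤ (m : ℝ) ^ 2 * b n)
    (hlim : Tendsto (fun n : ℕ => b n / (n : ℝ) ^ 2) atTop (nhds (1 / 2))) :
    ∀ n : ℕ, 1 ≤ n → (1 / 2 : ℝ) * (n : ℝ) ^ 2 ≤ b n := by
  intro n hn
  have hn0 : (0 : ℝ) < n := by exact_mod_cast hn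
  have hmul : Tendsto (fun m : ℕ => m * n) atTop atTop :=
    tendsto_id.atTop_mul_const' hn
  have hle : (1 / 2 : ℝ) ≤ b n / (n : ℝ) ^ 2 := by
    refine le_of_tendsto (hlim.comp hmul) ?_
    filter_upwards [eventually_ge_atTop 1] with m hm
    have hm0 : (0 : ℝ) < m := by exact_mod_cast hm
    simp only [Function.comp_apply]
    push_cast
    rw [div_le_div_iff₀ (by positivity) (by positivity)]
    calc b (m * n) * (n : ℝ) ^ 2 ≤ (m : ℝ) ^ 2 * b n * (n : ℝ) ^ 2 := by
          gcongr
          exact hb m n hm hn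
      _ = b n * ((m : ℝ) * n) ^ 2 := by ring
  exact (le_div_iff₀ (by positivity)).mp hle
end
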